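/- Let L be a complete bounded lattice. Define a binary operation * on L × L (the convolution of addition on the two-element group ℤ₂) by (a₀,a₁) * (b₀,b₁) = ((a₀ ⊓ b₀) ⊔ (a₁ ⊓ b₁), (a₀ ⊓ b₁) ⊔ (a₁ ⊓ b₀)). Then * is associative if and only if L is a distributive lattice. -/

import Mathlib

/-- The convolution over `L` of the addition of the two-element group `ℤ₂`, on pairs of
elements of `L`. -/
def z2conv {L : Type*} [CompleteLattice L] (a b : L × L) : L × L :=
  ((a.1 ⊓ b.1) ⊔ (a.2 ⊓ b.2), (a.1 ⊓ b.2) ⊔ (a.2 ⊓ b.1))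

/-- For a complete bounded lattice `L`, the convolution of the addition of `ℤ₂` is
associative iff `L` is distributive. -/
theorem stmt_11 {L : Type*} [CompleteLattice L] :
    (∀ a b c : L × L, z2conv (z2conv a b) c = z2conv a (z2conv b c)) ↔
    (∀ a b c : L, a ⊓ (b ⊔ c) = (a ⊓ b) ⊔ (a ⊓ c)) := by
  constructor
  · intro assoc a b c
    have key := congrArg Prod.fst (assoc (a, ⊥) (b, c) (⊤, ⊤))
    simpa [z2conv] using key.symm
  · intro distrib a b c
    have distrib' (x y z : L) : (x ⊔ y) ⊓ z = (x ⊓ z) ⊔ (y ⊓ z) := by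
      rw [inf_comm, distrib, inf_comm z x, inf_comm z y]
    apply Prod.ext <;> simp only [z2conv, distrib, distrib'] <;> ac_rfl
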